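/- (Theorem 1) Let the digraph be strongly connected and weight-balanced, suppose A x = b has at least one solution, and assume the null space of A is contained in the null space of each A_i. Let α, β > 0 and define γ̄ = max{ (2/λ₂(L + Lᵀ)) · λ_max( Q12ᵀQ12 / λ₂(Q11) − nβ𝒜𝒜ᵀ ), 0 }, where Q11 = (1/2)α(𝐋 + 𝐋ᵀ) + β𝒜ᵀ𝟙_m𝟙_mᵀ𝒜 and Q12 = (1/2)(nβ𝒜ᵀ + α𝐋ᵀ𝒜ᵀ + β𝒜ᵀ𝟙_m𝟙_mᵀ𝒜𝒜ᵀ). Then for all γ > γ̄, every trajectory (x(t), y(t)) of the distributed dynamics ẋ = −α𝐋x − nβ𝒜ᵀy, ẏ = −α𝒜𝐋x − nβ𝒜𝒜ᵀy − γ𝐋y with initial condition satisfying 𝟙_mᵀy(0) = 𝟙_mᵀ(𝒜x(0) − 𝐛) converges exponentially to (x*, 0), where x* = 𝟙_n ⊗ x̂ and x̂ ∈ ℝ^m solves A x̂ = b. -/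

import Mathlib

open Matrix

noncomputable section

/-- Laplacian `L = D^in − Adj`, where `D^in` is the diagonal matrix of weighted
in-degrees (column sums of `Adj`). -/
def lap {n : ℕ} (Adj : Matrix (Fin n) (Fin n) ℝ) : Matrix (Fin n) (Fin n) ℝ :=
  Matrix.diagonal (fun i => ∑ j, Adj j i) - Adj

/-- Strong connectivity: there is a directed path between any two distinct
vertices, where there is an edge from `i` to `j` iff `Adj i j > 0`. -/
def StronglyConnected {n : ℕ} (Adj : Matrix (Fin n) (Fin n) ℝ) : Prop :=
  ∀ i j : Fin n, i ≠ j → Relation.TransGen (fun a b => 0 < Adj a b) i j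

/-- Weight-balanced: `L 𝟙 = 0`. -/
def WeightBalanced {n : ℕ} (Adj : Matrix (Fin n) (Fin n) ℝ) : Prop :=
  (lap Adj).mulVec (fun _ => (1 : ℝ)) = 0

/-- `𝐋 = L ⊗ I_m`. -/
def bigL (m : ℕ) {n : ℕ} (Adj : Matrix (Fin n) (Fin n) ℝ) :
    Matrix (Fin n × Fin m) (Fin n × Fin m) ℝ :=
  Matrix.kroneckerMap (· * ·) (lap Adj) (1 : Matrix (Fin m) (Fin m) ℝ)

/-- `𝒜 = blockdiag(A_1, …, A_n)`. -/
def blkDiag {n m : ℕ} (A : Fin n → Matrix (Fin m) (Fin m) ℝ) :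
    Matrix (Fin n × Fin m) (Fin n × Fin m) ℝ :=
  fun p q => if p.1 = q.1 then A p.1 p.2 q.2 else 0

/-- `𝟙_m = 𝟙_n ⊗ I_m`. -/
def onesM (n m : ℕ) : Matrix (Fin n × Fin m) (Fin m) ℝ :=
  fun p j => if p.2 = j then 1 else 0

/-- The stacked vector `𝐛 = (b_1; …; b_n)`. -/
def stackVec {n m : ℕ} (b : Fin n → Fin m → ℝ) : Fin n × Fin m → ℝ := fun p => b p.1 p.2

/-- The consensus vector `𝟙_n ⊗ x`. -/
def consensus (n : ℕ) {m : ℕ} (x : Fin m → ℝ) : Fin n × Fin m → ℝ := fun p => x p.2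

/-- `λ_max`: the largest (real) eigenvalue of a real (symmetric) matrix. -/
def lamMax {ι : Type*} [Fintype ι] (M : Matrix ι ι ℝ) : ℝ :=
  sSup {μ : ℝ | ∃ v : ι → ℝ, v ≠ 0 ∧ M.mulVec v = μ • v}

/-- `λ₂`: the smallest nonzero (real) eigenvalue of a real (symmetric positive
semidefinite) matrix. -/
def lam2 {ι : Type*} [Fintype ι] (M : Matrix ι ι ℝ) : ℝ :=
  sInf {μ : ℝ | μ ≠ 0 ∧ ∃ v : ι → ℝ, v ≠ 0 ∧ M.mulVec v = μ • v}

/-- Right-hand side of the `x`-dynamics of the distributed algorithm: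
`ẋ = −α𝐋x − nβ𝒜ᵀy`. -/
def rhsX {n m : ℕ} (Adj : Matrix (Fin n) (Fin n) ℝ)
    (A : Fin n → Matrix (Fin m) (Fin m) ℝ) (α β : ℝ)
    (x y : Fin n × Fin m → ℝ) : Fin n × Fin m → ℝ :=
  -(α • (bigL m Adj).mulVec x) - ((n : ℝ) * β) • (blkDiag A)ᵀ.mulVec y

/-- Right-hand side of the `y`-dynamics of the distributed algorithm:
`ẏ = −α𝒜𝐋x − nβ𝒜𝒜ᵀy − γ𝐋y`. -/
def rhsY {n m : ℕ} (Adj : Matrix (Fin n) (Fin n) ℝ)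
    (A : Fin n → Matrix (Fin m) (Fin m) ℝ) (α β γ : ℝ)
    (x y : Fin n × Fin m → ℝ) : Fin n × Fin m → ℝ :=
  -(α • (blkDiag A * bigL m Adj).mulVec x)
    - ((n : ℝ) * β) • (blkDiag A * (blkDiag A)ᵀ).mulVec y
    - γ • (bigL m Adj).mulVec y

/-- `Q11 = (1/2)α(𝐋 + 𝐋ᵀ) + β𝒜ᵀ𝟙_m𝟙_mᵀ𝒜`. -/
def matQ11 {n m : ℕ} (Adj : Matrix (Fin n) (Fin n) ℝ)
    (A : Fin n → Matrix (Fin m) (Fin m) ℝ) (α β : ℝ) :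
    Matrix (Fin n × Fin m) (Fin n × Fin m) ℝ :=
  (α / 2) • (bigL m Adj + (bigL m Adj)ᵀ)
    + β • ((blkDiag A)ᵀ * onesM n m * (onesM n m)ᵀ * blkDiag A)

/-- `Q12 = (1/2)(nβ𝒜ᵀ + α𝐋ᵀ𝒜ᵀ + β𝒜ᵀ𝟙_m𝟙_mᵀ𝒜𝒜ᵀ)`. -/
def matQ12 {n m : ℕ} (Adj : Matrix (Fin n) (Fin n) ℝ)
    (A : Fin n → Matrix (Fin m) (Fin m) ℝ) (α β : ℝ) :
    Matrix (Fin n × Fin m) (Fin n × Fin m) ℝ :=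
  (1 / 2 : ℝ) • (((n : ℝ) * β) • (blkDiag A)ᵀ + α • ((bigL m Adj)ᵀ * (blkDiag A)ᵀ)
    + β • ((blkDiag A)ᵀ * onesM n m * (onesM n m)ᵀ * blkDiag A * (blkDiag A)ᵀ))

/-- The threshold
`γ̄ = max{ (2/λ₂(L + Lᵀ)) · λ_max( Q12ᵀQ12/λ₂(Q11) − nβ𝒜𝒜ᵀ ), 0 }`. -/
def gammaBar {n m : ℕ} (Adj : Matrix (Fin n) (Fin n) ℝ)
    (A : Fin n → Matrix (Fin m) (Fin m) ℝ) (α β : ℝ) : ℝ :=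
  max ((2 / lam2 (lap Adj + (lap Adj)ᵀ)) *
    lamMax ((lam2 (matQ11 Adj A α β))⁻¹ • ((matQ12 Adj A α β)ᵀ * matQ12 Adj A α β)
      - ((n : ℝ) * β) • (blkDiag A * (blkDiag A)ᵀ))) 0

section Spectral

variable {ι : Type*} [Fintype ι]

/-- Diagonalization of the quadratic form of a real symmetric matrix. -/
lemma Matrix.IsHermitian.exists_eigenvector_expansion {M : Matrix ι ι ℝ} (hM : M.IsHermitian) :
    ∃ (μ : ι → ℝ) (u : ι → ι → ℝ), (∀ i, u i ≠ 0 ∧ M *ᵥ u i = μ i • u i) ∧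
      ∀ v, v ⬝ᵥ v = ∑ i, (u i ⬝ᵥ v) ^ 2 ∧ v ⬝ᵥ M *ᵥ v = ∑ i, μ i * (u i ⬝ᵥ v) ^ 2 := by
  classical
  have key (v w : ι → ℝ) : v ⬝ᵥ w =
      ∑ i, ((hM.eigenvectorBasis i).ofLp ⬝ᵥ v) * ((hM.eigenvectorBasis i).ofLp ⬝ᵥ w) := by
    have h := hM.eigenvectorBasis.sum_inner_mul_inner (WithLp.toLp 2 v) (WithLp.toLp 2 w)
    simp only [EuclideanSpace.inner_eq_star_dotProduct, star_trivial] at h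
    rw [dotProduct_comm v w, ← h]
    exact Finset.sum_congr rfl fun i _ => by rw [dotProduct_comm w]
  refine ⟨hM.eigenvalues, fun i => (hM.eigenvectorBasis i).ofLp, fun i => ⟨fun h => ?_, ?_⟩,
    fun v => ⟨?_, ?_⟩⟩
  · exact hM.eigenvectorBasis.toBasis.ne_zero i (by simpa using h)
  · exact hM.mulVec_eigenvectorBasis i
  · simp only [key v v, sq]
  · rw [key v (M *ᵥ v)]
    refine Finset.sum_congr rfl fun i _ => ?_
    have hT : Mᵀ = M := by simpa [IsHermitian, conjTranspose] using hM
    have hsymm : (hM.eigenvectorBasis i).ofLp ⬝ᵥ M *ᵥ v =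
        (M *ᵥ (hM.eigenvectorBasis i).ofLp) ⬝ᵥ v := by
      rw [dotProduct_mulVec, ← mulVec_transpose, hT]
    rw [hsymm, hM.mulVec_eigenvectorBasis, smul_dotProduct, smul_eq_mul]
    ring

lemma finite_setOf_eigenvalue (M : Matrix ι ι ℝ) :
    {μ : ℝ | ∃ v : ι → ℝ, v ≠ 0 ∧ M.mulVec v = μ • v}.Finite := by
  classical
  refine (Module.End.finite_hasEigenvalue M.mulVecLin).subset ?_
  rintro μ ⟨v, hv, h⟩
  exact Module.End.hasEigenvalue_of_hasEigenvector
    (Module.End.hasEigenvector_iff.2 ⟨Module.End.mem_eigenspace_iff.2 h, hv⟩)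

lemma dotProduct_mulVec_le_lamMax {M : Matrix ι ι ℝ} (hM : M.IsHermitian) (v : ι → ℝ) :
    v ⬝ᵥ M *ᵥ v ≤ lamMax M * (v ⬝ᵥ v) := by
  obtain ⟨μ, u, hu, hv⟩ := hM.exists_eigenvector_expansion
  rw [(hv v).1, (hv v).2, Finset.mul_sum]
  gcongr with i
  exact le_csSup (finite_setOf_eigenvalue M).bddAbove ⟨u i, hu i⟩

lemma lam2_pos {M : Matrix ι ι ℝ} (hM : M.PosSemidef) (h0 : M ≠ 0) : 0 < lam2 M := by
  classical
  have hfin : {μ : ℝ | μ ≠ 0 ∧ ∃ v : ι → ℝ, v ≠ 0 ∧ M.mulVec v = μ • v}.Finite :=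
    (finite_setOf_eigenvalue M).subset fun μ h => h.2
  obtain ⟨v, μ, hμ, hv, h⟩ := hM.isHermitian.exists_eigenvector_of_ne_zero h0
  have hmem : lam2 M ∈ {μ : ℝ | μ ≠ 0 ∧ ∃ v : ι → ℝ, v ≠ 0 ∧ M.mulVec v = μ • v} :=
    Set.Nonempty.csInf_mem ⟨μ, hμ, v, hv, h⟩ hfin
  obtain ⟨hne, w, hw, hMw⟩ := hmem
  refine lt_of_le_of_ne ?_ (Ne.symm hne)
  have h1 := hM.dotProduct_mulVec_nonneg w
  rw [hMw, dotProduct_smul, star_trivial, smul_eq_mul] at h1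
  have h2 : 0 < w ⬝ᵥ w := lt_of_le_of_ne (Finset.sum_nonneg fun i _ => mul_self_nonneg _)
    (Ne.symm (mt dotProduct_self_eq_zero.1 hw))
  exact nonneg_of_mul_nonneg_left h1 h2

lemma lam2_mul_le_dotProduct_mulVec {M : Matrix ι ι ℝ} (hM : M.PosSemidef) {v : ι → ℝ}
    (hker : ∀ w, M *ᵥ w = 0 → w ⬝ᵥ v = 0) : lam2 M * (v ⬝ᵥ v) ≤ v ⬝ᵥ M *ᵥ v := by
  obtain ⟨μ, u, hu, hv⟩ := hM.isHermitian.exists_eigenvector_expansion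
  rw [(hv v).1, (hv v).2, Finset.mul_sum]
  refine Finset.sum_le_sum fun i _ => ?_
  by_cases hμ : μ i = 0
  · simp [hker (u i) (by rw [(hu i).2, hμ, zero_smul])]
  · gcongr
    exact csInf_le ((finite_setOf_eigenvalue M).subset fun μ h => h.2).bddBelow ⟨hμ, u i, hu i⟩

/-- Orthogonal projection of a vector onto the null space of a matrix. -/
lemma exists_ker_proj {κ : Type*} (M : Matrix κ ι ℝ) (u : ι → ℝ) :
    ∃ p, M *ᵥ p = 0 ∧ ∀ w, M *ᵥ w = 0 → w ⬝ᵥ (u - p) = 0 := by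
  classical
  let K : Submodule ℝ (EuclideanSpace ℝ ι) :=
    (LinearMap.ker M.mulVecLin).comap (WithLp.linearEquiv 2 ℝ (ι → ℝ)).toLinearMap
  refine ⟨(K.starProjection (WithLp.toLp 2 u)).ofLp,
    (K.starProjection_apply_mem (WithLp.toLp 2 u)), fun w hw => ?_⟩
  have h := K.starProjection_inner_eq_zero (WithLp.toLp 2 u) (WithLp.toLp 2 w) hw
  simpa [EuclideanSpace.inner_eq_star_dotProduct] using h

end Spectral

section Laplacian

variable {n : ℕ} {Adj : Matrix (Fin n) (Fin n) ℝ}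

lemma lap_mulVec (v : Fin n → ℝ) (i : Fin n) :
    (lap Adj *ᵥ v) i = (∑ j, Adj j i) * v i - ∑ j, Adj i j * v j := by
  rw [lap, sub_mulVec, Pi.sub_apply, mulVec_diagonal]
  rfl

lemma WeightBalanced.sum_eq (h : WeightBalanced Adj) (i : Fin n) :
    ∑ j, Adj j i = ∑ j, Adj i j := by
  have := congrFun h i
  rw [lap_mulVec] at this
  simpa [sub_eq_zero] using this

lemma sum_lap_mulVec (v : Fin n → ℝ) : ∑ i, (lap Adj *ᵥ v) i = 0 := by
  simp only [lap_mulVec, Finset.sum_sub_distrib, Finset.sum_mul]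
  rw [Finset.sum_comm, sub_self]

lemma WeightBalanced.dotProduct_lap_mulVec (h : WeightBalanced Adj) (v : Fin n → ℝ) :
    v ⬝ᵥ lap Adj *ᵥ v = 1 / 2 * ∑ i, ∑ j, Adj i j * (v i - v j) ^ 2 := by
  have h1 : ∑ i, ∑ j, Adj i j * v i ^ 2 = ∑ i, (∑ j, Adj j i) * v i ^ 2 := by
    simp only [h.sum_eq, Finset.sum_mul]
  have h2 : ∑ i, ∑ j, Adj i j * v j ^ 2 = ∑ i, (∑ j, Adj j i) * v i ^ 2 := by
    rw [Finset.sum_comm]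
    simp only [Finset.sum_mul]
  have h3 : ∑ i, ∑ j, Adj i j * (v i - v j) ^ 2 = ∑ i, ∑ j, Adj i j * v i ^ 2
      + ∑ i, ∑ j, Adj i j * v j ^ 2 - 2 * ∑ i, ∑ j, v i * (Adj i j * v j) := by
    simp only [Finset.mul_sum, ← Finset.sum_add_distrib, ← Finset.sum_sub_distrib]
    exact Finset.sum_congr rfl fun i _ => Finset.sum_congr rfl fun j _ => by ring
  have h4 : v ⬝ᵥ lap Adj *ᵥ v = ∑ i, (∑ j, Adj j i) * v i ^ 2
      - ∑ i, ∑ j, v i * (Adj i j * v j) := by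
    simp only [dotProduct, lap_mulVec, mul_sub, Finset.sum_sub_distrib, Finset.mul_sum]
    congr 1
    exact Finset.sum_congr rfl fun i _ => by
      rw [Finset.sum_mul, Finset.sum_mul, Finset.mul_sum]
      exact Finset.sum_congr rfl fun j _ => by ring
  rw [h4, h3, h1, h2]
  ring

lemma WeightBalanced.dotProduct_lap_mulVec_nonneg (h : WeightBalanced Adj)
    (hAdj : ∀ i j, 0 ≤ Adj i j) (v : Fin n → ℝ) : 0 ≤ v ⬝ᵥ lap Adj *ᵥ v := by
  rw [h.dotProduct_lap_mulVec]
  exact mul_nonneg (by norm_num) (Finset.sum_nonneg fun i _ => Finset.sum_nonneg fun j _ =>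
    mul_nonneg (hAdj i j) (sq_nonneg _))

lemma WeightBalanced.eq_of_dotProduct_lap_mulVec_eq_zero (h : WeightBalanced Adj)
    (hAdj : ∀ i j, 0 ≤ Adj i j) (hSC : StronglyConnected Adj) {v : Fin n → ℝ}
    (hv : v ⬝ᵥ lap Adj *ᵥ v = 0) (i j : Fin n) : v i = v j := by
  have hnn (i j) : 0 ≤ Adj i j * (v i - v j) ^ 2 := mul_nonneg (hAdj i j) (sq_nonneg _)
  have hedge (a b) (hab : 0 < Adj a b) : v a = v b := by
    rw [h.dotProduct_lap_mulVec] at hv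
    have h0 : ∑ i, ∑ j, Adj i j * (v i - v j) ^ 2 = 0 := by linarith
    have h1 := (Finset.sum_eq_zero_iff_of_nonneg
      fun i _ => Finset.sum_nonneg fun j _ => hnn i j).1 h0 a (Finset.mem_univ a)
    have h2 := (Finset.sum_eq_zero_iff_of_nonneg fun j _ => hnn a j).1 h1 b (Finset.mem_univ b)
    simpa [hab.ne', sub_eq_zero] using h2
  by_cases hij : i = j
  · rw [hij]
  · have hpath := hSC i j hij
    induction hpath with
    | single hb => exact hedge _ _ hb
    | tail _ hb ih =>
      rename_i b c _
      by_cases hib : i = b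
      · exact hib ▸ hedge _ _ hb
      · exact (ih hib).trans (hedge _ _ hb)

lemma dotProduct_add_transpose_mulVec {ι : Type*} [Fintype ι] (M : Matrix ι ι ℝ) (v : ι → ℝ) :
    v ⬝ᵥ (M + Mᵀ) *ᵥ v = 2 * (v ⬝ᵥ M *ᵥ v) := by
  rw [add_mulVec, dotProduct_add, dotProduct_transpose_mulVec]
  ring

lemma posSemidef_add_transpose {ι : Type*} [Fintype ι] {M : Matrix ι ι ℝ}
    (hM : ∀ v, 0 ≤ v ⬝ᵥ M *ᵥ v) : (M + Mᵀ).PosSemidef := by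
  refine PosSemidef.of_dotProduct_mulVec_nonneg ?_ fun v => ?_
  · rw [IsHermitian, conjTranspose_eq_transpose_of_trivial, transpose_add, transpose_transpose,
      add_comm]
  · rw [star_trivial, dotProduct_add_transpose_mulVec]
    linarith [hM v]

lemma WeightBalanced.lam2_lap_pos (h : WeightBalanced Adj) (hAdj : ∀ i j, 0 ≤ Adj i j)
    (hSC : StronglyConnected Adj) (hn : 2 ≤ n) : 0 < lam2 (lap Adj + (lap Adj)ᵀ) := by
  refine lam2_pos (posSemidef_add_transpose (h.dotProduct_lap_mulVec_nonneg hAdj)) fun h0 => ?_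
  have hform := dotProduct_add_transpose_mulVec (lap Adj) (Pi.single (⟨0, by omega⟩ : Fin n) 1)
  rw [h0, zero_mulVec, dotProduct_zero] at hform
  have := h.eq_of_dotProduct_lap_mulVec_eq_zero hAdj hSC
    (v := Pi.single (⟨0, by omega⟩ : Fin n) 1) (by linarith) ⟨0, by omega⟩ ⟨1, by omega⟩
  simp at this

lemma WeightBalanced.lam2_lap_mul_le (h : WeightBalanced Adj) (hAdj : ∀ i j, 0 ≤ Adj i j)
    (hSC : StronglyConnected Adj) {v : Fin n → ℝ} (hv : ∑ i, v i = 0) :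
    lam2 (lap Adj + (lap Adj)ᵀ) * (v ⬝ᵥ v) ≤ 2 * (v ⬝ᵥ lap Adj *ᵥ v) := by
  rw [← dotProduct_add_transpose_mulVec]
  refine lam2_mul_le_dotProduct_mulVec
    (posSemidef_add_transpose (h.dotProduct_lap_mulVec_nonneg hAdj)) fun w hw => ?_
  have hform := dotProduct_add_transpose_mulVec (lap Adj) w
  rw [hw, dotProduct_zero] at hform
  have hconst := h.eq_of_dotProduct_lap_mulVec_eq_zero hAdj hSC (v := w) (by linarith)
  rcases isEmpty_or_nonempty (Fin n) with he | ⟨⟨i₀⟩⟩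
  · simp [dotProduct]
  · simp only [dotProduct, fun i => hconst i i₀, ← Finset.mul_sum, hv, mul_zero]

end Laplacian

section Blocks

variable {n m : ℕ} {Adj : Matrix (Fin n) (Fin n) ℝ} {A : Fin n → Matrix (Fin m) (Fin m) ℝ}

lemma bigL_mulVec (z : Fin n × Fin m → ℝ) (p : Fin n × Fin m) :
    (bigL m Adj *ᵥ z) p = (lap Adj *ᵥ fun i => z (i, p.2)) p.1 := by
  simp [bigL, mulVec, dotProduct, Fintype.sum_prod_type, kroneckerMap_apply, one_apply]

lemma blkDiag_mulVec (z : Fin n × Fin m → ℝ) (p : Fin n × Fin m) :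
    (blkDiag A *ᵥ z) p = (A p.1 *ᵥ fun k => z (p.1, k)) p.2 := by
  simp only [blkDiag, mulVec, dotProduct, Fintype.sum_prod_type]
  rw [Finset.sum_eq_single p.1 (fun i _ hi => by simp [hi.symm]) (by simp)]
  simp

lemma onesM_mulVec (v : Fin m → ℝ) : onesM n m *ᵥ v = consensus n v := by
  ext p
  simp [onesM, consensus, mulVec, dotProduct]

lemma onesM_transpose_mulVec (z : Fin n × Fin m → ℝ) (k : Fin m) :
    ((onesM n m)ᵀ *ᵥ z) k = ∑ i, z (i, k) := by
  simp [onesM, mulVec, dotProduct, Fintype.sum_prod_type]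

lemma WeightBalanced.bigL_mulVec_onesM (h : WeightBalanced Adj) (v : Fin m → ℝ) :
    bigL m Adj *ᵥ onesM n m *ᵥ v = 0 := by
  ext p
  rw [bigL_mulVec, onesM_mulVec, lap_mulVec]
  simp [consensus, ← Finset.sum_mul, h.sum_eq]

lemma onesM_transpose_mulVec_bigL (z : Fin n × Fin m → ℝ) :
    (onesM n m)ᵀ *ᵥ bigL m Adj *ᵥ z = 0 := by
  ext k
  simp only [onesM_transpose_mulVec, bigL_mulVec, sum_lap_mulVec, Pi.zero_apply]

lemma onesM_transpose_mulVec_onesM (v : Fin m → ℝ) :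
    (onesM n m)ᵀ *ᵥ onesM n m *ᵥ v = (n : ℝ) • v := by
  ext k
  simp [onesM_transpose_mulVec, onesM_mulVec, consensus]

lemma onesM_transpose_mulVec_blkDiag_onesM (v : Fin m → ℝ) :
    (onesM n m)ᵀ *ᵥ blkDiag A *ᵥ onesM n m *ᵥ v = (∑ i, A i) *ᵥ v := by
  ext k
  simp [onesM_transpose_mulVec, onesM_mulVec, blkDiag_mulVec, consensus, sum_mulVec]

lemma onesM_transpose_mulVec_stackVec (b : Fin n → Fin m → ℝ) :
    (onesM n m)ᵀ *ᵥ stackVec b = ∑ i, b i := by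
  ext k
  simp [onesM_transpose_mulVec, stackVec]

lemma dotProduct_bigL_mulVec (z : Fin n × Fin m → ℝ) :
    z ⬝ᵥ bigL m Adj *ᵥ z = ∑ k, (fun i => z (i, k)) ⬝ᵥ lap Adj *ᵥ fun i => z (i, k) := by
  simp only [dotProduct, Fintype.sum_prod_type, bigL_mulVec]
  exact Finset.sum_comm

lemma WeightBalanced.dotProduct_bigL_mulVec_nonneg (h : WeightBalanced Adj)
    (hAdj : ∀ i j, 0 ≤ Adj i j) (z : Fin n × Fin m → ℝ) : 0 ≤ z ⬝ᵥ bigL m Adj *ᵥ z := by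
  rw [dotProduct_bigL_mulVec]
  exact Finset.sum_nonneg fun k _ => h.dotProduct_lap_mulVec_nonneg hAdj _

lemma WeightBalanced.exists_eq_onesM_mulVec (h : WeightBalanced Adj)
    (hAdj : ∀ i j, 0 ≤ Adj i j) (hSC : StronglyConnected Adj) (hn : 2 ≤ n)
    {z : Fin n × Fin m → ℝ} (hz : z ⬝ᵥ bigL m Adj *ᵥ z = 0) : ∃ v, z = onesM n m *ᵥ v := by
  rw [dotProduct_bigL_mulVec, Finset.sum_eq_zero_iff_of_nonneg
    fun k _ => h.dotProduct_lap_mulVec_nonneg hAdj _] at hz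
  refine ⟨fun k => z (⟨0, by omega⟩, k), ?_⟩
  ext ⟨i, k⟩
  rw [onesM_mulVec]
  exact h.eq_of_dotProduct_lap_mulVec_eq_zero hAdj hSC (hz k (Finset.mem_univ k)) i _

lemma WeightBalanced.lam2_lap_mul_le_bigL (h : WeightBalanced Adj)
    (hAdj : ∀ i j, 0 ≤ Adj i j) (hSC : StronglyConnected Adj) {z : Fin n × Fin m → ℝ}
    (hz : (onesM n m)ᵀ *ᵥ z = 0) :
    lam2 (lap Adj + (lap Adj)ᵀ) * (z ⬝ᵥ z) ≤ 2 * (z ⬝ᵥ bigL m Adj *ᵥ z) := by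
  have hzz : z ⬝ᵥ z = ∑ k, (fun i => z (i, k)) ⬝ᵥ fun i => z (i, k) := by
    simp only [dotProduct, Fintype.sum_prod_type]
    exact Finset.sum_comm
  rw [dotProduct_bigL_mulVec, hzz, Finset.mul_sum, Finset.mul_sum]
  refine Finset.sum_le_sum fun k _ => h.lam2_lap_mul_le hAdj hSC ?_
  rw [← onesM_transpose_mulVec, hz, Pi.zero_apply]

end Blocks

section Lyapunov

variable {n m : ℕ} {Adj : Matrix (Fin n) (Fin n) ℝ} {A : Fin n → Matrix (Fin m) (Fin m) ℝ}
  {α β γ : ℝ}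

lemma dotProduct_matQ11_mulVec (z : Fin n × Fin m → ℝ) :
    z ⬝ᵥ matQ11 Adj A α β *ᵥ z = α * (z ⬝ᵥ bigL m Adj *ᵥ z) +
      β * (((onesM n m)ᵀ *ᵥ blkDiag A *ᵥ z) ⬝ᵥ ((onesM n m)ᵀ *ᵥ blkDiag A *ᵥ z)) := by
  rw [matQ11, add_mulVec, dotProduct_add, smul_mulVec, dotProduct_smul, smul_mulVec,
    dotProduct_smul]
  simp only [← mulVec_mulVec, smul_eq_mul]
  rw [dotProduct_transpose_mulVec (blkDiag A), dotProduct_comm (onesM n m *ᵥ _),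
    ← dotProduct_transpose_mulVec (onesM n m), dotProduct_add_transpose_mulVec]
  ring

lemma WeightBalanced.posSemidef_matQ11 (h : WeightBalanced Adj) (hAdj : ∀ i j, 0 ≤ Adj i j)
    (hα : 0 ≤ α) (hβ : 0 ≤ β) : (matQ11 Adj A α β).PosSemidef := by
  refine ((posSemidef_add_transpose (h.dotProduct_bigL_mulVec_nonneg hAdj)).smul
    (by positivity)).add (PosSemidef.smul ?_ hβ)
  simpa [conjTranspose_eq_transpose_of_trivial, Matrix.mul_assoc] using
    posSemidef_conjTranspose_mul_self ((onesM n m)ᵀ * blkDiag A)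

lemma WeightBalanced.exists_of_dotProduct_matQ11_eq_zero (h : WeightBalanced Adj)
    (hAdj : ∀ i j, 0 ≤ Adj i j) (hSC : StronglyConnected Adj) (hn : 2 ≤ n) (hα : 0 < α)
    (hβ : 0 < β) {z : Fin n × Fin m → ℝ} (hz : z ⬝ᵥ matQ11 Adj A α β *ᵥ z = 0) :
    ∃ v, z = onesM n m *ᵥ v ∧ (∑ i, A i) *ᵥ v = 0 := by
  rw [dotProduct_matQ11_mulVec] at hz
  have h1 := mul_nonneg hα.le (h.dotProduct_bigL_mulVec_nonneg hAdj z)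
  have h2 : 0 ≤ β * (((onesM n m)ᵀ *ᵥ blkDiag A *ᵥ z) ⬝ᵥ ((onesM n m)ᵀ *ᵥ blkDiag A *ᵥ z)) :=
    mul_nonneg hβ.le (Finset.sum_nonneg fun i _ => mul_self_nonneg _)
  have h3 : α * (z ⬝ᵥ bigL m Adj *ᵥ z) = 0 := by linarith
  have h4 : β * (((onesM n m)ᵀ *ᵥ blkDiag A *ᵥ z) ⬝ᵥ ((onesM n m)ᵀ *ᵥ blkDiag A *ᵥ z)) = 0 := by
    linarith
  obtain ⟨v, rfl⟩ := h.exists_eq_onesM_mulVec hAdj hSC hn ((mul_eq_zero.1 h3).resolve_left hα.ne')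
  refine ⟨v, rfl, ?_⟩
  rw [← onesM_transpose_mulVec_blkDiag_onesM]
  exact dotProduct_self_eq_zero.1 ((mul_eq_zero.1 h4).resolve_left hβ.ne')

lemma WeightBalanced.lam2_matQ11_pos (h : WeightBalanced Adj)
    (hAdj : ∀ i j, 0 ≤ Adj i j) (hSC : StronglyConnected Adj) (hn : 2 ≤ n) (hm : 0 < m)
    (hα : 0 < α) (hβ : 0 < β) : 0 < lam2 (matQ11 Adj A α β) := by
  refine lam2_pos (h.posSemidef_matQ11 hAdj hα.le hβ.le) fun h0 => ?_
  obtain ⟨v, hv, -⟩ := h.exists_of_dotProduct_matQ11_eq_zero (A := A) hAdj hSC hn hα hβ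
    (z := Pi.single (⟨0, by omega⟩, ⟨0, hm⟩) 1) (by simp [h0])
  rw [onesM_mulVec] at hv
  have h1 := congrFun hv (⟨0, by omega⟩, ⟨0, hm⟩)
  have h2 := congrFun hv (⟨1, by omega⟩, ⟨0, hm⟩)
  simp only [consensus, Pi.single_eq_same] at h1 h2
  rw [← h1] at h2
  simp at h2

/-- Strict convexity of the block quadratic form with blocks `Q11`, `Q12` and
`nβ𝒜𝒜ᵀ + γ𝐋`, transversally to the null space of `Q11` and to consensus. -/
lemma exists_coercive (h : WeightBalanced Adj) (hAdj : ∀ i j, 0 ≤ Adj i j)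
    (hSC : StronglyConnected Adj) (hn : 2 ≤ n) (hm : 0 < m) (hα : 0 < α) (hβ : 0 < β)
    (hγ : gammaBar Adj A α β < γ) :
    ∃ c > 0, ∀ e s : Fin n × Fin m → ℝ,
      (∀ v, (∑ i, A i) *ᵥ v = 0 → (onesM n m *ᵥ v) ⬝ᵥ e = 0) → (onesM n m)ᵀ *ᵥ s = 0 →
      c * (e ⬝ᵥ e + s ⬝ᵥ s) ≤ e ⬝ᵥ matQ11 Adj A α β *ᵥ e + 2 * (e ⬝ᵥ matQ12 Adj A α β *ᵥ s)
        + n * β * (s ⬝ᵥ blkDiag A *ᵥ (blkDiag A)ᵀ *ᵥ s) + γ * (s ⬝ᵥ bigL m Adj *ᵥ s) := by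
  set Q := matQ12 Adj A α β with hQ
  set l := lam2 (matQ11 Adj A α β) with hl
  set μ := lam2 (lap Adj + (lap Adj)ᵀ) with hμ
  set M := l⁻¹ • (Qᵀ * Q) - ((n : ℝ) * β) • (blkDiag A * (blkDiag A)ᵀ) with hM
  have hlpos : 0 < l := h.lam2_matQ11_pos hAdj hSC hn hm hα hβ
  have hμpos : 0 < μ := h.lam2_lap_pos hAdj hSC hn
  have hγ0 : 0 < γ := (le_max_right _ _).trans_lt hγ
  have hδ : 0 < γ * μ / 2 - lamMax M := by
    have h1 : 2 / μ * lamMax M < γ := (le_max_left _ _).trans_lt hγ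
    rw [div_mul_eq_mul_div, div_lt_iff₀ hμpos] at h1
    linarith
  have hMherm : M.IsHermitian := by
    rw [IsHermitian, conjTranspose_eq_transpose_of_trivial]
    simp [hM]
  have hQQ : (Qᵀ * Q).IsHermitian := by
    rw [IsHermitian, conjTranspose_eq_transpose_of_trivial]
    simp
  set δ := γ * μ / 2 - lamMax M with hδdef
  set K := 2 * |lamMax (Qᵀ * Q)| / l ^ 2 + 1 with hK
  have hKpos : 0 < K := by positivity
  refine ⟨min (l / 2) (δ / K), by positivity, fun e s he hs => ?_⟩
  set q := Q *ᵥ s with hq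
  have hqq : s ⬝ᵥ (Qᵀ * Q) *ᵥ s = q ⬝ᵥ q := by
    rw [← mulVec_mulVec, dotProduct_transpose_mulVec]
  have h11 : l * (e ⬝ᵥ e) ≤ e ⬝ᵥ matQ11 Adj A α β *ᵥ e := by
    refine lam2_mul_le_dotProduct_mulVec (h.posSemidef_matQ11 hAdj hα.le hβ.le) fun w hw => ?_
    obtain ⟨v, rfl, hv⟩ := h.exists_of_dotProduct_matQ11_eq_zero (A := A) hAdj hSC hn hα hβ
      (z := w) (by rw [hw, dotProduct_zero])
    exact he v hv
  have h22 : l⁻¹ * (q ⬝ᵥ q) - n * β * (s ⬝ᵥ blkDiag A *ᵥ (blkDiag A)ᵀ *ᵥ s)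
      ≤ lamMax M * (s ⬝ᵥ s) := by
    have := dotProduct_mulVec_le_lamMax hMherm s
    rwa [hM, sub_mulVec, dotProduct_sub, smul_mulVec, dotProduct_smul, smul_mulVec,
      dotProduct_smul, hqq, ← mulVec_mulVec, ← hM] at this
  have hL : γ * (μ * (s ⬝ᵥ s)) ≤ γ * (2 * (s ⬝ᵥ bigL m Adj *ᵥ s)) :=
    mul_le_mul_of_nonneg_left (h.lam2_lap_mul_le_bigL hAdj hSC hs) hγ0.le
  have hs0 : 0 ≤ s ⬝ᵥ s := Finset.sum_nonneg fun i _ => mul_self_nonneg _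
  have hqs : q ⬝ᵥ q ≤ |lamMax (Qᵀ * Q)| * (s ⬝ᵥ s) := by
    rw [← hqq]
    exact (dotProduct_mulVec_le_lamMax hQQ s).trans
      (mul_le_mul_of_nonneg_right (le_abs_self _) hs0)
  set T := (e + l⁻¹ • q) ⬝ᵥ (e + l⁻¹ • q) with hT
  have hTeq : l * T = l * (e ⬝ᵥ e) + 2 * (e ⬝ᵥ q) + l⁻¹ * (q ⬝ᵥ q) := by
    simp only [hT, add_dotProduct, dotProduct_add, smul_dotProduct, dotProduct_smul, smul_eq_mul,
      dotProduct_comm q e]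
    field_simp
    ring
  have hT0 : 0 ≤ T := Finset.sum_nonneg fun i _ => mul_self_nonneg _
  have hE : e ⬝ᵥ e + s ⬝ᵥ s ≤ 2 * T + K * (s ⬝ᵥ s) := by
    have h1 : 0 ≤ (e + (2 * l⁻¹) • q) ⬝ᵥ (e + (2 * l⁻¹) • q) :=
      Finset.sum_nonneg fun i _ => mul_self_nonneg _
    have h2 : (e + (2 * l⁻¹) • q) ⬝ᵥ (e + (2 * l⁻¹) • q)
        = 2 * T - e ⬝ᵥ e + 2 * (q ⬝ᵥ q) / l ^ 2 := by
      simp only [hT, add_dotProduct, dotProduct_add, smul_dotProduct, dotProduct_smul, smul_eq_mul,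
        dotProduct_comm q e]
      field_simp
      ring
    have h3 : 2 * (q ⬝ᵥ q) / l ^ 2 ≤ 2 * (|lamMax (Qᵀ * Q)| * (s ⬝ᵥ s)) / l ^ 2 := by gcongr
    have h4 : K * (s ⬝ᵥ s) = 2 * (|lamMax (Qᵀ * Q)| * (s ⬝ᵥ s)) / l ^ 2 + s ⬝ᵥ s := by
      rw [hK]
      ring
    linarith
  calc min (l / 2) (δ / K) * (e ⬝ᵥ e + s ⬝ᵥ s)
      ≤ min (l / 2) (δ / K) * (2 * T + K * (s ⬝ᵥ s)) := by gcongr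
    _ = min (l / 2) (δ / K) * (2 * T) + min (l / 2) (δ / K) * (K * (s ⬝ᵥ s)) := mul_add _ _ _
    _ ≤ l / 2 * (2 * T) + δ / K * (K * (s ⬝ᵥ s)) := by
        gcongr
        · exact min_le_left _ _
        · exact min_le_right _ _
    _ = l * T + δ * (s ⬝ᵥ s) := by
        field_simp
    _ ≤ _ := by
        rw [hTeq, hδdef]
        linarith

/-- The energy balance along the distributed dynamics, where `s` is the disagreement part of `y`. -/
lemma energy_identity (hn : 2 ≤ n) (e s y : Fin n × Fin m → ℝ)
    (hy : y = s + (n : ℝ)⁻¹ • onesM n m *ᵥ (onesM n m)ᵀ *ᵥ blkDiag A *ᵥ e) :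
    e ⬝ᵥ rhsX Adj A α β e y + s ⬝ᵥ blkDiag A *ᵥ rhsX Adj A α β e y =
      -(e ⬝ᵥ matQ11 Adj A α β *ᵥ e + 2 * (e ⬝ᵥ matQ12 Adj A α β *ᵥ s)
        + n * β * (s ⬝ᵥ blkDiag A *ᵥ (blkDiag A)ᵀ *ᵥ s)) := by
  have hn0 : (n : ℝ) ≠ 0 := by positivity
  have hrhs : rhsX Adj A α β e y = -(α • bigL m Adj *ᵥ e) - (n * β) • (blkDiag A)ᵀ *ᵥ s
      - β • (blkDiag A)ᵀ *ᵥ onesM n m *ᵥ (onesM n m)ᵀ *ᵥ blkDiag A *ᵥ e := by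
    rw [rhsX, hy, mulVec_add, mulVec_smul, smul_add, smul_smul, sub_sub]
    congr 4
    field_simp
  have h12 : 2 * (e ⬝ᵥ matQ12 Adj A α β *ᵥ s) = n * β * (e ⬝ᵥ (blkDiag A)ᵀ *ᵥ s)
      + α * (s ⬝ᵥ blkDiag A *ᵥ bigL m Adj *ᵥ e)
      + β * (s ⬝ᵥ blkDiag A *ᵥ (blkDiag A)ᵀ *ᵥ onesM n m *ᵥ (onesM n m)ᵀ *ᵥ blkDiag A *ᵥ e) := by
    have h1 : e ⬝ᵥ (bigL m Adj)ᵀ *ᵥ (blkDiag A)ᵀ *ᵥ s = s ⬝ᵥ blkDiag A *ᵥ bigL m Adj *ᵥ e := by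
      rw [mulVec_mulVec, ← transpose_mul, dotProduct_transpose_mulVec, mulVec_mulVec]
    have h2 : e ⬝ᵥ (blkDiag A)ᵀ *ᵥ onesM n m *ᵥ (onesM n m)ᵀ *ᵥ blkDiag A *ᵥ (blkDiag A)ᵀ *ᵥ s =
        s ⬝ᵥ blkDiag A *ᵥ (blkDiag A)ᵀ *ᵥ onesM n m *ᵥ (onesM n m)ᵀ *ᵥ blkDiag A *ᵥ e := by
      simp only [mulVec_mulVec]
      rw [← dotProduct_transpose_mulVec]
      simp only [transpose_mul, transpose_transpose, Matrix.mul_assoc]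
    simp only [matQ12, smul_mulVec, add_mulVec, dotProduct_smul, dotProduct_add, smul_eq_mul,
      ← mulVec_mulVec, h1, h2]
    ring
  have h11 : e ⬝ᵥ matQ11 Adj A α β *ᵥ e = α * (e ⬝ᵥ bigL m Adj *ᵥ e)
      + β * (e ⬝ᵥ (blkDiag A)ᵀ *ᵥ onesM n m *ᵥ (onesM n m)ᵀ *ᵥ blkDiag A *ᵥ e) := by
    rw [dotProduct_matQ11_mulVec, dotProduct_transpose_mulVec (blkDiag A),
      dotProduct_comm (onesM n m *ᵥ _), ← dotProduct_transpose_mulVec (onesM n m)]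
  rw [h12, h11, hrhs]
  simp only [mulVec_sub, mulVec_neg, mulVec_smul, dotProduct_sub, dotProduct_neg, dotProduct_smul,
    smul_eq_mul]
  ring

end Lyapunov

section Calculus

variable {ι : Type*} [Fintype ι]

lemma HasDerivAt.mulVec {κ : Type*} [Fintype κ] {f : ℝ → ι → ℝ} {f' : ι → ℝ} {t : ℝ}
    (hf : HasDerivAt f f' t) (M : Matrix κ ι ℝ) :
    HasDerivAt (fun t => M *ᵥ f t) (M *ᵥ f') t :=
  M.mulVecLin.toContinuousLinearMap.hasFDerivAt.comp_hasDerivAt t hf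

lemma HasDerivAt.const_dotProduct {f : ℝ → ι → ℝ} {f' : ι → ℝ} {t : ℝ}
    (hf : HasDerivAt f f' t) (w : ι → ℝ) : HasDerivAt (fun t => w ⬝ᵥ f t) (w ⬝ᵥ f') t :=
  HasDerivAt.fun_sum fun i _ => (hasDerivAt_pi.1 hf i).const_mul (w i)

lemma HasDerivAt.dotProduct_self {f : ℝ → ι → ℝ} {f' : ι → ℝ} {t : ℝ}
    (hf : HasDerivAt f f' t) : HasDerivAt (fun t => f t ⬝ᵥ f t) (2 * (f t ⬝ᵥ f')) t := by
  have h : 2 * (f t ⬝ᵥ f') = ∑ i, (f' i * f t i + f t i * f' i) := by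
    rw [dotProduct, Finset.mul_sum]
    exact Finset.sum_congr rfl fun i _ => by ring
  rw [h]
  exact HasDerivAt.fun_sum fun i _ => (hasDerivAt_pi.1 hf i).mul (hasDerivAt_pi.1 hf i)

lemma eq_of_hasDerivAt_zero {E : Type*} [NormedAddCommGroup E] [NormedSpace ℝ E] {f : ℝ → E}
    (hf : ∀ t, 0 ≤ t → HasDerivAt f 0 t) (t : ℝ) (ht : 0 ≤ t) : f t = f 0 :=
  constant_of_has_deriv_right_zero
    (fun s hs => (hf s hs.1).continuousAt.continuousWithinAt)
    (fun s hs => (hf s hs.1).hasDerivWithinAt) t ⟨ht, le_rfl⟩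

/-- Grönwall's inequality for a linear differential inequality on `[0, ∞)`. -/
lemma le_mul_exp_of_hasDerivAt_le {V V' : ℝ → ℝ} {k : ℝ}
    (hV : ∀ t, 0 ≤ t → HasDerivAt V (V' t) t) (hle : ∀ t, 0 ≤ t → V' t ≤ -k * V t)
    (t : ℝ) (ht : 0 ≤ t) : V t ≤ V 0 * Real.exp (-k * t) := by
  have hW (s : ℝ) (hs : 0 ≤ s) : HasDerivAt (fun s => V s * Real.exp (k * s))
      (V' s * Real.exp (k * s) + V s * (Real.exp (k * s) * k)) s :=
    (hV s hs).mul (by simpa using ((hasDerivAt_id s).const_mul k).exp)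
  have hanti : AntitoneOn (fun s => V s * Real.exp (k * s)) (Set.Ici 0) := by
    refine antitoneOn_of_hasDerivWithinAt_nonpos (convex_Ici 0)
      (fun s hs => (hW s hs).continuousAt.continuousWithinAt)
      (fun s hs => (hW s (interior_subset hs)).hasDerivWithinAt) fun s hs => ?_
    have h1 := mul_le_mul_of_nonneg_right (hle s (interior_subset hs)) (Real.exp_pos (k * s)).le
    linarith
  have h := hanti Set.self_mem_Ici ht ht
  simp only [mul_zero, Real.exp_zero, mul_one] at h
  rwa [neg_mul, Real.exp_neg, ← div_eq_mul_inv, le_div_iff₀ (Real.exp_pos _)]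

lemma norm_le_sqrt_dotProduct_self (z : ι → ℝ) : ‖z‖ ≤ √(z ⬝ᵥ z) := by
  refine (pi_norm_le_iff_of_nonneg (Real.sqrt_nonneg _)).2 fun i => Real.abs_le_sqrt ?_
  rw [sq]
  exact Finset.single_le_sum (f := fun i => z i * z i) (fun j _ => mul_self_nonneg _)
    (Finset.mem_univ i)

lemma exists_norm_mulVec_le {κ : Type*} [Fintype κ] (M : Matrix κ ι ℝ) :
    ∃ K, 0 ≤ K ∧ ∀ v, ‖M *ᵥ v‖ ≤ K * ‖v‖ :=
  ⟨‖M.mulVecLin.toContinuousLinearMap‖, norm_nonneg _,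
    fun v => M.mulVecLin.toContinuousLinearMap.le_opNorm v⟩

end Calculus

/-- Theorem 1: over a strongly connected weight-balanced digraph,
with `Ax = b` solvable and `null(A) ⊆ null(A_i)` for each `i`, for `α, β > 0` and
any `γ > γ̄`, every trajectory of the distributed dynamics with initial condition
`𝟙_mᵀy(0) = 𝟙_mᵀ(𝒜x(0) − 𝐛)` converges exponentially to `(𝟙_n ⊗ x̂, 0)` where
`x̂` solves `Ax̂ = b`. -/
theorem stmt8 {n m : ℕ} (hn : 2 ≤ n)
    (Adj : Matrix (Fin n) (Fin n) ℝ) (hAdj : ∀ i j, 0 ≤ Adj i j)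
    (hSC : StronglyConnected Adj) (hWB : WeightBalanced Adj)
    (A : Fin n → Matrix (Fin m) (Fin m) ℝ) (b : Fin n → Fin m → ℝ)
    (hsol : ∃ x0 : Fin m → ℝ, (∑ i, A i).mulVec x0 = ∑ i, b i)
    (hnull : ∀ v : Fin m → ℝ, (∑ i, A i).mulVec v = 0 → ∀ i, (A i).mulVec v = 0)
    (α β γ : ℝ) (hα : 0 < α) (hβ : 0 < β)
    (hγ : gammaBar Adj A α β < γ)
    (x y : ℝ → Fin n × Fin m → ℝ)
    (hx : ∀ t : ℝ, 0 ≤ t → HasDerivAt x (rhsX Adj A α β (x t) (y t)) t)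
    (hy : ∀ t : ℝ, 0 ≤ t → HasDerivAt y (rhsY Adj A α β γ (x t) (y t)) t)
    (hinit : (onesM n m)ᵀ.mulVec (y 0) =
      (onesM n m)ᵀ.mulVec ((blkDiag A).mulVec (x 0) - stackVec b)) :
    ∃ xh : Fin m → ℝ, (∑ i, A i).mulVec xh = ∑ i, b i ∧
      ∃ C κ : ℝ, 0 < C ∧ 0 < κ ∧
        ∀ t : ℝ, 0 ≤ t →
          ‖x t - consensus n xh‖ ≤ C * Real.exp (-κ * t) ∧
          ‖y t‖ ≤ C * Real.exp (-κ * t) := by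
  rcases Nat.eq_zero_or_pos m with rfl | hm
  · obtain ⟨xh, hxh⟩ := hsol
    refine ⟨xh, hxh, 1, 1, one_pos, one_pos, fun t _ => ⟨?_, ?_⟩⟩
    · rw [Subsingleton.elim (x t - consensus n xh) 0, norm_zero]
      positivity
    · rw [Subsingleton.elim (y t) 0, norm_zero]
      positivity
  have hn0 : (n : ℝ) ≠ 0 := by positivity
  obtain ⟨x0, hx0⟩ := hsol
  obtain ⟨p, hp, hproj⟩ := exists_ker_proj (∑ i, A i) ((n : ℝ)⁻¹ • (onesM n m)ᵀ *ᵥ x 0 - x0)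
  have hxh : (∑ i, A i) *ᵥ (x0 + p) = ∑ i, b i := by rw [mulVec_add, hx0, hp, add_zero]
  refine ⟨x0 + p, hxh, ?_⟩
  set e : ℝ → Fin n × Fin m → ℝ := fun t => x t - onesM n m *ᵥ (x0 + p) with he_def
  have hPx (t : ℝ) : bigL m Adj *ᵥ x t = bigL m Adj *ᵥ e t := by
    rw [he_def, mulVec_sub, hWB.bigL_mulVec_onesM, sub_zero]
  have he (t : ℝ) (ht : 0 ≤ t) : HasDerivAt e (rhsX Adj A α β (e t) (y t)) t := by
    have := (hx t ht).sub_const (onesM n m *ᵥ (x0 + p))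
    rwa [rhsX, hPx] at this
  have hy' (t : ℝ) (ht : 0 ≤ t) : HasDerivAt y
      (blkDiag A *ᵥ rhsX Adj A α β (e t) (y t) - γ • bigL m Adj *ᵥ y t) t := by
    have := hy t ht
    rw [rhsY, ← mulVec_mulVec, hPx] at this
    rw [rhsX, mulVec_sub, mulVec_neg, mulVec_smul, mulVec_smul, mulVec_mulVec _ (blkDiag A)
      (blkDiag A)ᵀ]
    exact this
  have hinv (t : ℝ) (ht : 0 ≤ t) :
      (onesM n m)ᵀ *ᵥ y t = (onesM n m)ᵀ *ᵥ blkDiag A *ᵥ e t := by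
    have h0 : (onesM n m)ᵀ *ᵥ (y 0 - blkDiag A *ᵥ e 0) = 0 := by
      rw [he_def, mulVec_sub, hinit, mulVec_sub (blkDiag A), mulVec_sub, mulVec_sub,
        onesM_transpose_mulVec_blkDiag_onesM, onesM_transpose_mulVec_stackVec, hxh, sub_self]
    have := eq_of_hasDerivAt_zero (f := fun t => (onesM n m)ᵀ *ᵥ (y t - blkDiag A *ᵥ e t))
      (fun t ht => by
        have := ((hy' t ht).sub ((he t ht).mulVec (blkDiag A))).mulVec (onesM n m)ᵀ
        rwa [sub_sub_cancel_left, mulVec_neg, mulVec_smul, onesM_transpose_mulVec_bigL, smul_zero,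
          neg_zero] at this) t ht
    rw [h0, mulVec_sub, sub_eq_zero] at this
    exact this
  have horth (t : ℝ) (ht : 0 ≤ t) (v : Fin m → ℝ) (hv : (∑ i, A i) *ᵥ v = 0) :
      (onesM n m *ᵥ v) ⬝ᵥ e t = 0 := by
    have h0 : (onesM n m *ᵥ v) ⬝ᵥ e 0 = 0 := by
      have h1 := hproj v hv
      rw [dotProduct_comm, ← dotProduct_transpose_mulVec, he_def, mulVec_sub,
        onesM_transpose_mulVec_onesM]
      have h2 : (onesM n m)ᵀ *ᵥ x 0 - (n : ℝ) • (x0 + p)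
          = (n : ℝ) • ((n : ℝ)⁻¹ • (onesM n m)ᵀ *ᵥ x 0 - x0 - p) := by
        rw [smul_sub, smul_sub, smul_inv_smul₀ hn0, smul_add, sub_sub]
      rw [h2, dotProduct_smul, h1, smul_zero]
    rw [← h0]
    refine eq_of_hasDerivAt_zero (f := fun t => (onesM n m *ᵥ v) ⬝ᵥ e t) (fun t ht => ?_) t ht
    have hder := (he t ht).const_dotProduct (onesM n m *ᵥ v)
    have hBO : blkDiag A *ᵥ onesM n m *ᵥ v = 0 := by
      ext q
      rw [blkDiag_mulVec, onesM_mulVec]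
      exact congrFun (hnull v hv q.1) q.2
    rw [rhsX, dotProduct_sub, dotProduct_neg, dotProduct_smul, dotProduct_smul,
      dotProduct_transpose_mulVec, hBO, dotProduct_zero, dotProduct_comm,
      ← dotProduct_transpose_mulVec, onesM_transpose_mulVec_bigL] at hder
    simpa using hder
  set s : ℝ → Fin n × Fin m → ℝ :=
    fun t => y t - (n : ℝ)⁻¹ • onesM n m *ᵥ (onesM n m)ᵀ *ᵥ y t with hs_def
  have hOs (t : ℝ) : (onesM n m)ᵀ *ᵥ s t = 0 := by
    rw [hs_def, mulVec_sub, mulVec_smul, onesM_transpose_mulVec_onesM, inv_smul_smul₀ hn0, sub_self]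
  have hys (t : ℝ) (ht : 0 ≤ t) :
      y t = s t + (n : ℝ)⁻¹ • onesM n m *ᵥ (onesM n m)ᵀ *ᵥ blkDiag A *ᵥ e t := by
    rw [← hinv t ht, hs_def, sub_add_cancel]
  have hPy (t : ℝ) : bigL m Adj *ᵥ y t = bigL m Adj *ᵥ s t := by
    rw [hs_def, mulVec_sub, mulVec_smul, hWB.bigL_mulVec_onesM, smul_zero, sub_zero]
  obtain ⟨c, hc, hcoer⟩ := exists_coercive (A := A) hWB hAdj hSC hn hm hα hβ hγ
  set V : ℝ → ℝ := fun t => e t ⬝ᵥ e t + s t ⬝ᵥ s t with hV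
  have hVdecay (t : ℝ) (ht : 0 ≤ t) : V t ≤ V 0 * Real.exp (-(2 * c) * t) := by
    refine le_mul_exp_of_hasDerivAt_le (V := V) (fun t ht => (he t ht).dotProduct_self.add
      ((hy' t ht).sub ((((hy' t ht).mulVec (onesM n m)ᵀ).mulVec
        (onesM n m)).const_smul (n : ℝ)⁻¹)).dotProduct_self) (fun t ht => ?_) t ht
    have hsO (w : Fin m → ℝ) : s t ⬝ᵥ onesM n m *ᵥ w = 0 := by
      rw [← dotProduct_transpose_mulVec, hOs, dotProduct_zero]
    have h1 := energy_identity (α := α) (β := β) (Adj := Adj) hn (e t) (s t) (y t) (hys t ht)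
    have h2 := hcoer (e t) (s t) (horth t ht) (hOs t)
    change 2 * (e t ⬝ᵥ _) + 2 * (s t ⬝ᵥ _) ≤ -(2 * c) * (e t ⬝ᵥ e t + s t ⬝ᵥ s t)
    rw [dotProduct_sub, dotProduct_smul, hsO, dotProduct_sub, dotProduct_smul, hPy]
    simp only [smul_eq_mul, mul_zero, sub_zero]
    linarith
  obtain ⟨K, hK0, hK⟩ := exists_norm_mulVec_le
    ((n : ℝ)⁻¹ • (onesM n m * (onesM n m)ᵀ * blkDiag A))
  have hexp (t : ℝ) : Real.exp (-(2 * c) * t) = Real.exp (-c * t) ^ 2 := by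
    rw [sq, ← Real.exp_add]
    ring_nf
  have hnonneg (z : Fin n × Fin m → ℝ) : 0 ≤ z ⬝ᵥ z :=
    Finset.sum_nonneg fun i _ => mul_self_nonneg _
  have hV0 : 0 ≤ V 0 := add_nonneg (hnonneg _) (hnonneg _)
  have hbound (t : ℝ) (ht : 0 ≤ t) (z : Fin n × Fin m → ℝ) (hz : z ⬝ᵥ z ≤ V t) :
      ‖z‖ ≤ (√(V 0) + 1) * Real.exp (-c * t) := by
    refine (norm_le_sqrt_dotProduct_self z).trans ((Real.sqrt_le_left (by positivity)).2 ?_)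
    rw [mul_pow, ← hexp]
    refine hz.trans ((hVdecay t ht).trans ?_)
    gcongr
    nlinarith [Real.sq_sqrt hV0, Real.sqrt_nonneg (V 0)]
  refine ⟨(1 + K) * (√(V 0) + 1), c, by positivity, hc, fun t ht => ?_⟩
  have hbe := hbound t ht (e t) (le_add_of_nonneg_right (hnonneg _))
  have hbs := hbound t ht (s t) (le_add_of_nonneg_left (hnonneg _))
  rw [mul_assoc, add_mul, one_mul]
  constructor
  · rw [← onesM_mulVec]
    exact hbe.trans (le_add_of_nonneg_right (by positivity))
  · rw [hys t ht]
    refine (norm_add_le _ _).trans (add_le_add hbs ?_)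
    have := hK (e t)
    rw [smul_mulVec, ← mulVec_mulVec, ← mulVec_mulVec] at this
    exact this.trans (by gcongr)
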